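/- arXiv:2410.22438 — 2 statements merged into one kernel-verified Lean document; each statement's English description precedes it below -/
import Mathlib

section
/- Let Ω ⊂ ℝ² be a bounded, open, simply connected domain with smooth boundary, b ∈ (0,1), ε > 0 and h_ex > 0. Let a : Ω → ℝ be measurable with b ≤ a ≤ 1, let ρ ∈ C¹(clos(Ω); ℝ) with √b ≤ ρ ≤ 1, let ξ ∈ C²(clos(Ω); ℝ) satisfy −div(∇ξ/ρ²) + ξ = 1 in Ω and ξ = 0 on ∂Ω, and set A⁰ := −∇⊥ξ/ρ². Then GL_ε(ρ, h_ex A⁰) = E_ε(ρ) + (h_ex²/2) ∫_Ω ( |∇ξ|²/ρ² + ξ² ). -/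
noncomputable section

open MeasureTheory

/-- The plane ℝ², with its Euclidean structure. -/
abbrev V2 : Type := EuclideanSpace ℝ (Fin 2)

/-- The first standard basis vector of the plane. -/
def ee1 : V2 := EuclideanSpace.single (0 : Fin 2) (1 : ℝ)

/-- The second standard basis vector of the plane. -/
def ee2 : V2 := EuclideanSpace.single (1 : Fin 2) (1 : ℝ)

/-- First partial derivative. -/
def pd1 {E : Type*} [NormedAddCommGroup E] [NormedSpace ℝ E] (f : V2 → E) (x : V2) : E :=
  fderiv ℝ f x ee1

/-- Second partial derivative. -/
def pd2 {E : Type*} [NormedAddCommGroup E] [NormedSpace ℝ E] (f : V2 → E) (x : V2) : E :=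
  fderiv ℝ f x ee2

/-- The vector of ℝ² with the given coordinates. -/
def mkV (a b : ℝ) : V2 := (EuclideanSpace.equiv (Fin 2) ℝ).symm ![a, b]

/-- Squared norm of the gradient of a real-valued function. -/
def gradSq (v : V2 → ℝ) (x : V2) : ℝ := (pd1 v x) ^ 2 + (pd2 v x) ^ 2

/-- First component of the covariant gradient ∇_A u = ∇u - iAu. -/
def covD1 (u : V2 → ℂ) (A : V2 → V2) (y : V2) : ℂ := pd1 u y - Complex.I * (A y 0 : ℂ) * u y

/-- Second component of the covariant gradient ∇_A u = ∇u - iAu. -/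
def covD2 (u : V2 → ℂ) (A : V2 → V2) (y : V2) : ℂ := pd2 u y - Complex.I * (A y 1 : ℂ) * u y

/-- Squared norm of the covariant gradient. -/
def covGradSq (u : V2 → ℂ) (A : V2 → V2) (x : V2) : ℝ :=
  ‖covD1 u A x‖ ^ 2 + ‖covD2 u A x‖ ^ 2

/-- Curl of a planar vector field. -/
def curl2 (A : V2 → V2) (x : V2) : ℝ :=
  pd1 (fun y => A y 1) x - pd2 (fun y => A y 0) x

/-- Divergence of a planar vector field. -/
def div2 (A : V2 → V2) (x : V2) : ℝ :=
  pd1 (fun y => A y 0) x + pd2 (fun y => A y 1) x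

/-- The real scalar product ⟨z,w⟩ = Re (z · conj w) on ℂ. -/
def rin (z w : ℂ) : ℝ := (z * (starRingEnd ℂ) w).re

/-- Superconducting current ⟨iu, ∇_A u⟩. -/
def scurrent (u : V2 → ℂ) (A : V2 → V2) (x : V2) : V2 :=
  mkV (rin (Complex.I * u x) (covD1 u A x)) (rin (Complex.I * u x) (covD2 u A x))

/-- Vorticity μ(u,A) = curl(⟨iu,∇_A u⟩ + A). -/
def vorticity (u : V2 → ℂ) (A : V2 → V2) (x : V2) : ℝ :=
  curl2 (fun y => scurrent u A y + A y) x

/-- Pinned Ginzburg–Landau energy without magnetic field (real-valued configuration). -/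
def Eeps (Ω : Set V2) (a : V2 → ℝ) (ε : ℝ) (v : V2 → ℝ) : ℝ :=
  (1 / 2) * ∫ x in Ω, (gradSq v x + (a x - v x ^ 2) ^ 2 / (2 * ε ^ 2))

/-- Weighted Ginzburg–Landau free energy F_{ε,ρ}(u,A). -/
def Feps (Ω : Set V2) (ε : ℝ) (ρ : V2 → ℝ) (u : V2 → ℂ) (A : V2 → V2) : ℝ :=
  (1 / 2) * ∫ x in Ω, (ρ x ^ 2 * covGradSq u A x
    + ρ x ^ 4 * (1 - ‖u x‖ ^ 2) ^ 2 / (2 * ε ^ 2) + curl2 A x ^ 2)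

/-- Full Ginzburg–Landau energy with pinning and applied field. -/
def GLeps (Ω : Set V2) (a : V2 → ℝ) (ε hex : ℝ) (u : V2 → ℂ) (A : V2 → V2) : ℝ :=
  (1 / 2) * ∫ x in Ω, (covGradSq u A x + (a x - ‖u x‖ ^ 2) ^ 2 / (2 * ε ^ 2)
    + (curl2 A x - hex) ^ 2)

/-- Weak (Neumann) Euler–Lagrange identity for ρ, tested against Lipschitz functions. -/
def WeakEL (Ω : Set V2) (a : V2 → ℝ) (ε : ℝ) (ρ : V2 → ℝ) : Prop :=
  ∀ φ : V2 → ℝ, (∃ K : NNReal, LipschitzWith K φ) →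
    ∫ x in Ω, (pd1 ρ x * pd1 φ x + pd2 ρ x * pd2 φ x)
      = (ε ^ 2)⁻¹ * ∫ x in Ω, ρ x * (a x - ρ x ^ 2) * φ x

/-- Data witnessing that the open set Ω has smooth boundary:
a global smooth defining function with nonvanishing gradient on the boundary. -/
structure SmoothBdry (Ω : Set V2) where
  f : V2 → ℝ
  smooth : ContDiff ℝ (⊤ : ℕ∞) f
  eq_set : Ω = {x | f x < 0}
  grad_ne : ∀ x ∈ frontier Ω, fderiv ℝ f x ≠ 0

/-- The outward unit normal to ∂Ω computed from a smooth defining function. -/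
def SmoothBdry.normal {Ω : Set V2} (sb : SmoothBdry Ω) (x : V2) : V2 :=
  ‖mkV (pd1 sb.f x) (pd2 sb.f x)‖⁻¹ • mkV (pd1 sb.f x) (pd2 sb.f x)

/-- The first Ginzburg–Landau equation -(div - iA·)(∇_A u) = u(a-|u|²)/ε² in Ω. -/
def GLeq1 (Ω : Set V2) (a : V2 → ℝ) (ε : ℝ) (u : V2 → ℂ) (A : V2 → V2) : Prop :=
  ∀ x ∈ Ω,
    -(pd1 (covD1 u A) x + pd2 (covD2 u A) x
        - Complex.I * ((A x 0 : ℂ) * covD1 u A x + (A x 1 : ℂ) * covD2 u A x))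
      = u x * ((a x - ‖u x‖ ^ 2 : ℝ) : ℂ) / (ε : ℂ) ^ 2

/-- The covariant Neumann boundary condition (∇_A u)·ν = 0 on ∂Ω. -/
def CovNeumann (Ω : Set V2) (sb : SmoothBdry Ω) (u : V2 → ℂ) (A : V2 → V2) : Prop :=
  ∀ x ∈ frontier Ω,
    covD1 u A x * (sb.normal x 0 : ℂ) + covD2 u A x * (sb.normal x 1 : ℂ) = 0

/-- The second Ginzburg–Landau equation -∇⊥(curl A) = ⟨iu, ∇_A u⟩ in Ω. -/
def GLeq2 (Ω : Set V2) (u : V2 → ℂ) (A : V2 → V2) : Prop :=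
  ∀ x ∈ Ω,
    pd2 (curl2 A) x = rin (Complex.I * u x) (covD1 u A x) ∧
    -(pd1 (curl2 A) x) = rin (Complex.I * u x) (covD2 u A x)

/-- Coulomb gauge: div A = 0 in Ω and A·ν = 0 on ∂Ω. -/
def CoulombGauge (Ω : Set V2) (sb : SmoothBdry Ω) (A : V2 → V2) : Prop :=
  (∀ x ∈ Ω, div2 A x = 0) ∧
  (∀ x ∈ frontier Ω, A x 0 * sb.normal x 0 + A x 1 * sb.normal x 1 = 0)

/-- The classical PDE -div(∇ξ/ρ²) + ξ = 1 at points of Ω. -/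
def XiPDE (Ω : Set V2) (ρ ξ : V2 → ℝ) : Prop :=
  ∀ x ∈ Ω,
    -(pd1 (fun y => pd1 ξ y / ρ y ^ 2) x + pd2 (fun y => pd2 ξ y / ρ y ^ 2) x) + ξ x = 1

/-- The Meissner approximation vector potential A⁰ = -∇⊥ξ/ρ². -/
def meissnerA0 (ρ ξ : V2 → ℝ) : V2 → V2 :=
  fun y => mkV (pd2 ξ y / ρ y ^ 2) (-(pd1 ξ y) / ρ y ^ 2)

theorem continuous_gradSq {v : V2 → ℝ} (hv : ContDiff ℝ 1 v) : Continuous (gradSq v) := by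
  have h := hv.continuous_fderiv one_ne_zero
  unfold gradSq pd1 pd2
  fun_prop

/-- For a real-valued order parameter the covariant gradient splits orthogonally. -/
theorem covGradSq_ofReal {ρ : V2 → ℝ} (A : V2 → V2) {x : V2} (hρ : DifferentiableAt ℝ ρ x) :
    covGradSq (fun y => (ρ y : ℂ)) A x
      = gradSq ρ x + ρ x ^ 2 * ((A x 0) ^ 2 + (A x 1) ^ 2) := by
  have hf (w : V2) : fderiv ℝ (fun y => (ρ y : ℂ)) x w = ((fderiv ℝ ρ x w : ℝ) : ℂ) := by
    have h := Complex.ofRealCLM.hasFDerivAt.comp x hρ.hasFDerivAt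
    have h' : HasFDerivAt (fun y => (ρ y : ℂ)) (Complex.ofRealCLM.comp (fderiv ℝ ρ x)) x := h
    rw [h'.fderiv]
    rfl
  have key (p q r : ℝ) : ‖(p : ℂ) - Complex.I * (q : ℂ) * (r : ℂ)‖ ^ 2 = p ^ 2 + r ^ 2 * q ^ 2 := by
    rw [← Complex.normSq_eq_norm_sq, Complex.normSq_apply]
    simp
    ring
  unfold covGradSq covD1 covD2 gradSq pd1 pd2
  rw [hf, hf, key, key]
  ring

theorem meissnerA0_apply_zero (ρ ξ : V2 → ℝ) (y : V2) :
    meissnerA0 ρ ξ y 0 = pd2 ξ y / ρ y ^ 2 := by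
  simp [meissnerA0, mkV]

theorem meissnerA0_apply_one (ρ ξ : V2 → ℝ) (y : V2) :
    meissnerA0 ρ ξ y 1 = -(pd1 ξ y / ρ y ^ 2) := by
  simp [meissnerA0, mkV, neg_div]

theorem curl2_smul (c : ℝ) (A : V2 → V2) (x : V2) :
    curl2 (fun y => c • A y) x = c * curl2 A x := by
  have h (f : V2 → ℝ) : fderiv ℝ (fun y => c * f y) x = c • fderiv ℝ f x :=
    congrFun (fderiv_const_smul_field (f := f) c) x
  simp only [curl2, pd1, pd2, PiLp.smul_apply, smul_eq_mul, h, smul_apply]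
  ring

theorem XiPDE.curl2_meissnerA0 {Ω : Set V2} {ρ ξ : V2 → ℝ} (h : XiPDE Ω ρ ξ) {x : V2}
    (hx : x ∈ Ω) : curl2 (meissnerA0 ρ ξ) x = 1 - ξ x := by
  have hn (f : V2 → ℝ) : pd1 (fun y => -f y) x = -pd1 f x := by
    simp [pd1, fderiv_fun_neg]
  have hp := h x hx
  simp only [curl2, meissnerA0_apply_zero, meissnerA0_apply_one, hn]
  linarith

/-- The integrand of the energy of `(ρ, c A⁰)` splits pointwise. -/
theorem GLeps_integrand_meissnerA0 {Ω : Set V2} {ρ ξ : V2 → ℝ} (h : XiPDE Ω ρ ξ) (c t : ℝ) {x : V2}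
    (hx : x ∈ Ω) (hρ : DifferentiableAt ℝ ρ x) (hρ0 : ρ x ≠ 0) :
    covGradSq (fun y => (ρ y : ℂ)) (fun y => c • meissnerA0 ρ ξ y) x + t
        + (curl2 (fun y => c • meissnerA0 ρ ξ y) x - c) ^ 2
      = (gradSq ρ x + t) + c ^ 2 * (gradSq ξ x / ρ x ^ 2 + ξ x ^ 2) := by
  rw [covGradSq_ofReal _ hρ, curl2_smul, h.curl2_meissnerA0 hx]
  simp only [PiLp.smul_apply, smul_eq_mul, meissnerA0_apply_zero, meissnerA0_apply_one]
  rw [gradSq.eq_1 ξ]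
  field_simp
  ring

theorem ContinuousOn.integrableOn_of_isBounded {Ω : Set V2} (hΩ : Bornology.IsBounded Ω)
    {g : V2 → ℝ} (hg : ContinuousOn g (closure Ω)) : IntegrableOn g Ω :=
  (hg.integrableOn_compact hΩ.isCompact_closure).mono_set subset_closure

theorem integrableOn_sq_sub_sq {Ω : Set V2} (hΩo : IsOpen Ω) (hΩb : Bornology.IsBounded Ω)
    {a ρ : V2 → ℝ} (ham : Measurable a) {m : ℝ} (ha : ∀ x ∈ Ω, |a x| ≤ m)
    (hρ : Continuous ρ) : IntegrableOn (fun x => (a x - ρ x ^ 2) ^ 2) Ω := by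
  obtain ⟨C, hC⟩ := hΩb.isCompact_closure.exists_bound_of_continuousOn
    (hρ.pow 2).continuousOn
  refine Measure.integrableOn_of_bounded (M := (m + C) ^ 2) hΩb.measure_lt_top.ne
    ((ham.sub (hρ.measurable.pow_const 2)).pow_const 2).aestronglyMeasurable ?_
  filter_upwards [ae_restrict_mem hΩo.measurableSet] with x hx
  have h1 := ha x hx
  have h2 : |ρ x ^ 2| ≤ C := hC x (subset_closure hx)
  rw [norm_pow, Real.norm_eq_abs]
  gcongr
  exact (abs_sub _ _).trans (add_le_add h1 h2)

/-- the energy of the approximate Meissner configuration. -/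
theorem statement10
    (Ω : Set V2) (hΩo : IsOpen Ω) (hΩb : Bornology.IsBounded Ω)
    (hΩsc : SimplyConnectedSpace ↥Ω) (hsb : Nonempty (SmoothBdry Ω))
    (b : ℝ) (hb : b ∈ Set.Ioo (0 : ℝ) 1)
    (ε : ℝ) (hε : 0 < ε) (hex : ℝ) (hhex : 0 < hex)
    (a : V2 → ℝ) (ham : Measurable a) (hab : ∀ x ∈ Ω, b ≤ a x ∧ a x ≤ 1)
    (ρ : V2 → ℝ) (hρ : ContDiff ℝ 1 ρ)
    (hρb : ∀ x ∈ closure Ω, Real.sqrt b ≤ ρ x ∧ ρ x ≤ 1)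
    (ξ : V2 → ℝ) (hξ : ContDiff ℝ 2 ξ)
    (hpde : XiPDE Ω ρ ξ)
    (hbd : ∀ x ∈ frontier Ω, ξ x = 0) :
    GLeps Ω a ε hex (fun y => (ρ y : ℂ)) (fun y => hex • meissnerA0 ρ ξ y)
      = Eeps Ω a ε ρ
        + (hex ^ 2 / 2) * ∫ x in Ω, (gradSq ξ x / ρ x ^ 2 + ξ x ^ 2) := by
  have hρ0 : ∀ x ∈ closure Ω, ρ x ≠ 0 := fun x hx =>
    ((Real.sqrt_pos.mpr hb.1).trans_le (hρb x hx).1).ne'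
  have hE : IntegrableOn (fun x => gradSq ρ x + (a x - ρ x ^ 2) ^ 2 / (2 * ε ^ 2)) Ω := by
    refine ((continuous_gradSq hρ).continuousOn.integrableOn_of_isBounded hΩb).add
      ((integrableOn_sq_sub_sq hΩo hΩb ham (m := 1) (fun x hx => ?_) hρ.continuous).div_const _)
    rw [abs_le]
    constructor <;> linarith [hb.1, (hab x hx).1, (hab x hx).2]
  have hX : IntegrableOn (fun x => gradSq ξ x / ρ x ^ 2 + ξ x ^ 2) Ω := by
    refine ContinuousOn.integrableOn_of_isBounded hΩb (ContinuousOn.add ?_ ?_)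
    · exact (continuous_gradSq (hξ.of_le one_le_two)).continuousOn.div
        (hρ.continuous.pow 2).continuousOn fun x hx => pow_ne_zero 2 (hρ0 x hx)
    · exact (hξ.continuous.pow 2).continuousOn
  have hsplit : ∫ x in Ω, (covGradSq (fun y => (ρ y : ℂ)) (fun y => hex • meissnerA0 ρ ξ y) x
        + (a x - ‖(ρ x : ℂ)‖ ^ 2) ^ 2 / (2 * ε ^ 2)
        + (curl2 (fun y => hex • meissnerA0 ρ ξ y) x - hex) ^ 2)
      = ∫ x in Ω, ((gradSq ρ x + (a x - ρ x ^ 2) ^ 2 / (2 * ε ^ 2))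
        + hex ^ 2 * (gradSq ξ x / ρ x ^ 2 + ξ x ^ 2)) := by
    refine setIntegral_congr_fun hΩo.measurableSet fun x hx => ?_
    have hn : ‖(ρ x : ℂ)‖ ^ 2 = ρ x ^ 2 := by rw [Complex.norm_real, Real.norm_eq_abs, sq_abs]
    simp only [hn]
    exact GLeps_integrand_meissnerA0 hpde hex _ hx (hρ.differentiable one_ne_zero x)
      (hρ0 x (subset_closure hx))
  unfold GLeps Eeps
  rw [hsplit, integral_add hE (hX.const_mul _), integral_const_mul]
  ring
end
end

section
/- Let Ω ⊂ ℝ² be a bounded open set with smooth boundary, b ∈ (0,1), and C̃, C₁ > 0. There exists a constant C > 0, depending only on Ω, b, C̃ and C₁, such that the following holds for every ε ∈ (0,1]. Let a : clos(Ω) → ℝ be continuous with b ≤ a ≤ 1, let ρ ∈ C¹(clos(Ω); ℝ) with √b ≤ ρ ≤ 1 and sup_Ω |∇ρ| ≤ C₁/ε, and let (𝐮, A) with 𝐮 ∈ C²(clos(Ω); ℂ), A ∈ C¹(clos(Ω); ℝ²), |𝐮| ≤ 1, be a classical solution of −(div − iA·)(∇𝐮 − iA𝐮) = 𝐮(a −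 |𝐮|²)/ε² in Ω with (∇𝐮 − iA𝐮)·ν = 0 on ∂Ω, where A satisfies the Coulomb gauge conditions div A = 0 in Ω, A·ν = 0 on ∂Ω, and sup_Ω |A| ≤ C̃/ε. Then sup_Ω |∇𝐮| ≤ C/ε and, setting u := 𝐮/ρ, also sup_Ω |∇u| ≤ C/ε. -/
noncomputable section

open MeasureTheory

open Filter Topology
open scoped InnerProductSpace

lemma hasDerivAt_comp_line {p : V2 → ℝ} (hp : ContDiff ℝ 2 p) (x e : V2) (t : ℝ) :
    HasDerivAt (fun t : ℝ => p (x + t • e)) (fderiv ℝ p (x + t • e) e) t := by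
  have h1 : HasDerivAt (fun t : ℝ => x + t • e) e t := by
    simpa using ((hasDerivAt_id t).smul_const e).const_add x
  exact ((hp.differentiable (by norm_num)) (x + t • e)).hasFDerivAt.comp_hasDerivAt t h1

lemma hasDerivAt_fderiv_comp_line {p : V2 → ℝ} (hp : ContDiff ℝ 2 p) (x e : V2) (t : ℝ) :
    HasDerivAt (fun t : ℝ => fderiv ℝ p (x + t • e) e)
      (fderiv ℝ (fderiv ℝ p) (x + t • e) e e) t := by
  have h1 : HasDerivAt (fun t : ℝ => x + t • e) e t := by
    simpa using ((hasDerivAt_id t).smul_const e).const_add x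
  have h2 : ContDiff ℝ 1 (fderiv ℝ p) := hp.fderiv_right (by norm_num)
  have h3 := ((h2.differentiable (by norm_num)) (x + t • e)).hasFDerivAt.comp_hasDerivAt t h1
  simpa using h3.clm_apply (hasDerivAt_const t e)

lemma second_deriv_nonpos_of_isLocalMax {h h' : ℝ → ℝ} {c x : ℝ}
    (hh : ∀ t, HasDerivAt h (h' t) t) (hh' : HasDerivAt h' c x) (hmax : IsLocalMax h x) :
    c ≤ 0 := by
  by_contra! hc
  have hd : deriv h = h' := funext fun t => (hh t).deriv
  have hmin : IsLocalMin h x :=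
    isLocalMin_of_deriv_deriv_pos (by rw [hd, hh'.deriv]; exact hc) hmax.deriv_eq_zero
      (hh x).continuousAt
  have heq : h =ᶠ[𝓝 x] fun _ => h x := by
    filter_upwards [hmax, hmin] with t h1 h2 using le_antisymm h1 h2
  have h2 : deriv (deriv h) x = 0 := by
    rw [heq.deriv.deriv_eq]; simp
  rw [hd, hh'.deriv] at h2
  exact hc.ne' h2

lemma hasDerivAt_norm_line {z d : V2} (hz : z ≠ 0) :
    HasDerivAt (fun t : ℝ => ‖z - t • d‖) (-(⟪d, z⟫_ℝ / ‖z‖)) 0 := by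
  have h1 : HasDerivAt (fun t : ℝ => z - t • d) (-d) 0 := by
    simpa using ((hasDerivAt_id (0 : ℝ)).smul_const d).const_sub z
  have h2 := (h1.norm_sq).sqrt (by simpa using hz)
  simp only [Real.sqrt_sq (norm_nonneg _), zero_smul, sub_zero] at h2
  convert h2 using 1
  rw [inner_neg_right, real_inner_comm]
  field_simp

/-- A penalised difference cannot be maximal at a boundary point at which the penalty strictly
increases in the conormal direction `d`. -/
lemma not_eventually_le_of_boundary {v g : V2 → ℝ} {x y d : V2} {L q : ℝ}
    (hv : DifferentiableAt ℝ v x) (hg : DifferentiableAt ℝ g x) (hvd : fderiv ℝ v x d = 0)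
    (hxy : x ≠ y) (hgd : -(g x * ⟪d, x - y⟫_ℝ) < ‖x - y‖ ^ 2 * fderiv ℝ g x d)
    (hgd0 : 0 ≤ fderiv ℝ g x d) (hgy : 0 < g y) (hq : 0 ≤ q) (hL : 2 * q * ‖x - y‖ < L) :
    ¬ ∀ᶠ t : ℝ in 𝓝[>] 0,
      v (x - t • d) - (L * ‖x - t • d - y‖ - q * ‖x - t • d - y‖ ^ 2) * (g (x - t • d) * g y)
        ≤ v x - (L * ‖x - y‖ - q * ‖x - y‖ ^ 2) * (g x * g y) := by
  intro hev
  have hz : x - y ≠ 0 := sub_ne_zero.2 hxy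
  have hs : 0 < ‖x - y‖ := norm_pos_iff.2 hz
  have line : HasDerivAt (fun t : ℝ => x - t • d) (-d) 0 := by
    simpa using ((hasDerivAt_id (0 : ℝ)).smul_const d).const_sub x
  have along : ∀ p : V2 → ℝ, DifferentiableAt ℝ p x →
      HasDerivAt (fun t : ℝ => p (x - t • d)) (-fderiv ℝ p x d) 0 := by
    intro p hp
    have hp' : HasFDerivAt p (fderiv ℝ p x) (x - (0 : ℝ) • d) := by simpa using hp.hasFDerivAt
    simpa [Function.comp_def] using hp'.comp_hasDerivAt 0 line
  have hn : HasDerivAt (fun t : ℝ => ‖x - t • d - y‖) (-(⟪d, x - y⟫_ℝ / ‖x - y‖)) 0 := by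
    refine (hasDerivAt_norm_line hz).congr_of_eventuallyEq (Eventually.of_forall fun t => ?_)
    simp only [sub_right_comm]
  have hψ := (along v hv).sub (((hn.const_mul L).sub ((hn.pow 2).const_mul q)).mul
    ((along g hg).mul_const (g y)))
  simp only [zero_smul, sub_zero, hvd] at hψ
  have hle := hψ.hasDerivWithinAt (s := Set.Ioi 0)
  rw [hasDerivWithinAt_iff_tendsto_slope' (by simp)] at hle
  have hnp := le_of_tendsto hle (b := 0) (by
    filter_upwards [hev, self_mem_nhdsWithin] with t ht ht0
    rw [slope_def_field]
    refine div_nonpos_of_nonpos_of_nonneg ?_ (by simpa using (le_of_lt ht0))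
    simp
    linarith)
  set s := ‖x - y‖
  set D := fderiv ℝ g x d
  set I := ⟪d, x - y⟫_ℝ
  have key : 0 < g y * ((L - 2 * q * s) * (g x * I / s) + (L * s - q * s ^ 2) * D) := by
    refine mul_pos hgy ?_
    have h1 : -(s * D) < g x * I / s := by
      rw [lt_div_iff₀ hs]; nlinarith
    have h2 : (L - 2 * q * s) * (-(s * D)) < (L - 2 * q * s) * (g x * I / s) :=
      mul_lt_mul_of_pos_left h1 (by linarith)
    have h3 : 0 ≤ q * s ^ 2 * D := by positivity
    nlinarith
  have : g y * ((L - 2 * q * s) * (g x * I / s) + (L * s - q * s ^ 2) * D) ≤ 0 := by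
    refine le_trans (le_of_eq ?_) hnp
    simp
    ring
  linarith

lemma eq_smul_ee (e : V2) : e = e 0 • ee1 + e 1 • ee2 := by
  ext i
  fin_cases i <;> simp [ee1, ee2]

/-- The trace of a bilinear form on the plane, computed in a rotated orthonormal frame. -/
lemma trace_rotated (B : V2 →L[ℝ] V2 →L[ℝ] ℝ) {e : V2} (he : ‖e‖ = 1) :
    B e e + B (mkV (-e 1) (e 0)) (mkV (-e 1) (e 0)) = B ee1 ee1 + B ee2 ee2 := by
  have h1 : e 0 ^ 2 + e 1 ^ 2 = 1 := by
    have := EuclideanSpace.real_norm_sq_eq e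
    rw [he, Fin.sum_univ_two] at this
    linarith
  have h2 : mkV (-e 1) (e 0) = (-e 1) • ee1 + e 0 • ee2 := by
    rw [eq_smul_ee (mkV (-e 1) (e 0))]
    simp [mkV]
  rw [h2]
  conv_lhs => enter [1]; rw [eq_smul_ee e]
  simp only [map_add, map_smul, add_apply, smul_apply,
    smul_eq_mul]
  linear_combination (B ee1 ee1 + B ee2 ee2) * h1

lemma norm_mkV_rot {e : V2} (he : ‖e‖ = 1) : ‖mkV (-e 1) (e 0)‖ = 1 := by
  rw [← he, EuclideanSpace.norm_eq, EuclideanSpace.norm_eq, Fin.sum_univ_two, Fin.sum_univ_two]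
  simp [mkV, add_comm]

/-- A smooth weight on `closure Ω` which increases towards the boundary fast enough in the
conormal direction `d` to compensate for the lack of convexity of `Ω`. -/
structure IsBoundaryWeight (Ω : Set V2) (d : V2 → V2) (g : V2 → ℝ) (m N : ℝ) : Prop where
  contDiff : ContDiff ℝ 2 g
  pos : 0 < m
  le_self : ∀ x ∈ closure Ω, m ≤ g x
  self_le : ∀ x ∈ closure Ω, g x ≤ 1
  nonneg : 0 ≤ N
  norm_fderiv_le : ∀ x ∈ closure Ω, ‖fderiv ℝ g x‖ ≤ N
  norm_fderiv_fderiv_le : ∀ x ∈ closure Ω, ‖fderiv ℝ (fderiv ℝ g) x‖ ≤ N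
  inward : ∀ x ∈ frontier Ω, ∀ᶠ t : ℝ in 𝓝[>] 0, x - t • d x ∈ Ω
  conormal_nonneg : ∀ x ∈ frontier Ω, 0 ≤ fderiv ℝ g x (d x)
  conormal_lt : ∀ x ∈ frontier Ω, ∀ y ∈ closure Ω, x ≠ y →
    -(g x * ⟪d x, x - y⟫_ℝ) < ‖x - y‖ ^ 2 * fderiv ℝ g x (d x)

set_option maxHeartbeats 1000000 in
/-- A penalised difference has no interior off-diagonal local maximum. -/
lemma not_localMax_interior {Ω : Set V2} {d : V2 → V2} {g v : V2 → ℝ} {m N K L q r : ℝ}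
    (hg : IsBoundaryWeight Ω d g m N) (hv : ContDiff ℝ 2 v) {x y : V2}
    (hx : x ∈ closure Ω) (hy : y ∈ closure Ω) (hxy : x ≠ y)
    (hKx : |fderiv ℝ (fderiv ℝ v) x ee1 ee1 + fderiv ℝ (fderiv ℝ v) x ee2 ee2| ≤ K)
    (hKy : |fderiv ℝ (fderiv ℝ v) y ee1 ee1 + fderiv ℝ (fderiv ℝ v) y ee2 ee2| ≤ K)
    (hq : 0 ≤ q) (hr : r ≤ 1) (hxyr : ‖x - y‖ < r) (hL : 2 * q * r ≤ L)
    (hbig : 2 * K + L * (12 * N + 4 * N ^ 2) < 8 * q * m ^ 2) :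
    ¬ ∀ᶠ p : V2 × V2 in 𝓝 (x, y),
      v p.1 - v p.2 - (L * ‖p.1 - p.2‖ - q * ‖p.1 - p.2‖ ^ 2) * (g p.1 * g p.2)
        ≤ v x - v y - (L * ‖x - y‖ - q * ‖x - y‖ ^ 2) * (g x * g y) := by
  intro hmax
  have hs : 0 < ‖x - y‖ := norm_pos_iff.2 (sub_ne_zero.2 hxy)
  set s := ‖x - y‖ with hsdef
  set e : V2 := s⁻¹ • (x - y) with hedef
  have he : ‖e‖ = 1 := by
    rw [hedef, norm_smul, Real.norm_of_nonneg (inv_nonneg.2 hs.le), ← hsdef,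
      inv_mul_cancel₀ hs.ne']
  set n : V2 := mkV (-e 1) (e 0) with hndef
  have hn : ‖n‖ = 1 := norm_mkV_rot he
  have hxe : x - y = s • e := by rw [hedef, smul_inv_smul₀ hs.ne']
  have hgc := hg.contDiff
  have D1 : ∀ t : ℝ, HasDerivAt (fun t : ℝ => L * (s + 2 * t) - q * (s + 2 * t) ^ 2)
      (2 * L - 4 * q * (s + 2 * t)) t := by
    intro t
    have h1 : HasDerivAt (fun t : ℝ => s + 2 * t) 2 t := by
      simpa using ((hasDerivAt_id t).const_mul 2).const_add s
    refine ((h1.const_mul L).sub ((h1.pow 2).const_mul q)).congr_deriv ?_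
    push_cast
    ring
  have D2 : HasDerivAt (fun t : ℝ => 2 * L - 4 * q * (s + 2 * t)) (-(8 * q)) 0 := by
    have h1 : HasDerivAt (fun t : ℝ => s + 2 * t) 2 0 := by
      simpa using ((hasDerivAt_id (0 : ℝ)).const_mul 2).const_add s
    exact ((h1.const_mul (4 * q)).const_sub (2 * L)).congr_deriv (by ring)
  have first : ∀ t : ℝ, HasDerivAt _ _ t := fun t =>
    ((((hasDerivAt_comp_line hv x e t).sub (hasDerivAt_comp_line hv y (-e) t)).add
      ((hasDerivAt_comp_line hv x n t).sub (hasDerivAt_comp_line hv y n t))).sub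
      ((D1 t).mul ((hasDerivAt_comp_line hgc x e t).mul (hasDerivAt_comp_line hgc y (-e) t)))).sub
      (((hasDerivAt_comp_line hgc x n t).mul (hasDerivAt_comp_line hgc y n t)).const_mul
        (L * s - q * s ^ 2))
  have second :=
    ((((hasDerivAt_fderiv_comp_line hv x e 0).sub (hasDerivAt_fderiv_comp_line hv y (-e) 0)).add
      ((hasDerivAt_fderiv_comp_line hv x n 0).sub (hasDerivAt_fderiv_comp_line hv y n 0))).sub
      ((D2.mul ((hasDerivAt_comp_line hgc x e 0).mul (hasDerivAt_comp_line hgc y (-e) 0))).add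
        ((D1 0).mul
          (((hasDerivAt_fderiv_comp_line hgc x e 0).mul (hasDerivAt_comp_line hgc y (-e) 0)).add
          ((hasDerivAt_comp_line hgc x e 0).mul (hasDerivAt_fderiv_comp_line hgc y (-e) 0)))))).sub
      ((((hasDerivAt_fderiv_comp_line hgc x n 0).mul (hasDerivAt_comp_line hgc y n 0)).add
        ((hasDerivAt_comp_line hgc x n 0).mul (hasDerivAt_fderiv_comp_line hgc y n 0))).const_mul
        (L * s - q * s ^ 2))
  have lim : ∀ w w' : V2, Tendsto (fun t : ℝ => (x + t • w, y + t • w')) (𝓝 0) (𝓝 (x, y)) := by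
    intro w w'
    have : Continuous fun t : ℝ => (x + t • w, y + t • w') := by fun_prop
    simpa using this.tendsto 0
  have hnp := second_deriv_nonpos_of_isLocalMax first second (by
    have hpos : ∀ᶠ t : ℝ in 𝓝 0, 0 < s + 2 * t :=
      (by fun_prop : Continuous fun t : ℝ => s + 2 * t).tendsto 0 |>.eventually
        (lt_mem_nhds (by simpa using hs))
    filter_upwards [(lim e (-e)).eventually hmax, (lim n n).eventually hmax, hpos]
      with t h1 h2 h3
    have e1 : ‖x + t • e - (y + t • (-e))‖ = s + 2 * t := by
      have : x + t • e - (y + t • (-e)) = (s + 2 * t) • e := by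
        rw [add_sub_add_comm, hxe]; module
      rw [this, norm_smul, he, mul_one, Real.norm_of_nonneg h3.le]
    have e2 : ‖x + t • n - (y + t • n)‖ = s := by
      rw [add_sub_add_right_eq_sub]
    simp only [e1, e2] at h1 h2
    rw [smul_neg] at h1
    simp
    linarith)
  have tx := trace_rotated (fderiv ℝ (fderiv ℝ v) x) he
  have ty := trace_rotated (fderiv ℝ (fderiv ℝ v) y) he
  rw [← hndef] at tx ty
  rw [← tx] at hKx
  rw [← ty] at hKy
  have dg : ∀ z ∈ closure Ω, ∀ w : V2, ‖w‖ = 1 → |fderiv ℝ g z w| ≤ N := by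
    intro z hz w hw
    have := (fderiv ℝ g z).le_opNorm w
    rw [hw, mul_one] at this
    exact this.trans (hg.norm_fderiv_le z hz)
  have ddg : ∀ z ∈ closure Ω, ∀ w : V2, ‖w‖ = 1 → |fderiv ℝ (fderiv ℝ g) z w w| ≤ N := by
    intro z hz w hw
    have := (fderiv ℝ (fderiv ℝ g) z).le_opNorm₂ w w
    rw [hw, mul_one, mul_one] at this
    exact this.trans (hg.norm_fderiv_fderiv_le z hz)
  have mulN : ∀ {α β P Q : ℝ}, |α| ≤ P → |β| ≤ Q → |α * β| ≤ P * Q := by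
    intro α β P Q h1 h2
    rw [abs_mul]
    exact mul_le_mul h1 h2 (abs_nonneg _) ((abs_nonneg _).trans h1)
  have hm := hg.pos
  have gx : |g x| ≤ 1 := by
    rw [abs_of_nonneg (hm.le.trans (hg.le_self x hx))]; exact hg.self_le x hx
  have gy : |g y| ≤ 1 := by
    rw [abs_of_nonneg (hm.le.trans (hg.le_self y hy))]; exact hg.self_le y hy
  have hgg : m ^ 2 ≤ g x * g y := by
    rw [sq]
    exact mul_le_mul (hg.le_self x hx) (hg.le_self y hy) hm.le (hm.le.trans (hg.le_self x hx))
  have b1 := abs_le.1 (mulN (dg x hx e he) gy)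
  have b2 := abs_le.1 (mulN gx (dg y hy e he))
  have b3 := abs_le.1 (mulN (ddg x hx e he) gy)
  have b4 := abs_le.1 (mulN gx (ddg y hy e he))
  have b5 := abs_le.1 (mulN (dg x hx e he) (dg y hy e he))
  have b6 := abs_le.1 (mulN (ddg x hx n hn) gy)
  have b7 := abs_le.1 (mulN gx (ddg y hy n hn))
  have b8 := abs_le.1 (mulN (dg x hx n hn) (dg y hy n hn))
  have kx := abs_le.1 hKx
  have ky := abs_le.1 hKy
  have hqs : q * s ≤ q * r := by gcongr
  have hqs0 : 0 ≤ q * s := by positivity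
  have hL0 : 0 ≤ L := by linarith
  have φ0 : 0 ≤ L * s - q * s ^ 2 := by
    have : 0 ≤ s * (L - q * s) := mul_nonneg hs.le (by linarith)
    linarith
  have φL : L * s - q * s ^ 2 ≤ L := by
    have h1 : L * s ≤ L := mul_le_of_le_one_right hL0 (by linarith)
    have h2 : 0 ≤ q * s ^ 2 := by positivity
    linarith
  have φ'0 : 0 ≤ 2 * L - 4 * q * s := by linarith
  have hN := hg.nonneg
  have hNN : 0 ≤ 2 * N + 2 * (N * N) := by positivity
  simp at hnp
  set φ := L * s - q * s ^ 2
  have t1 : 8 * q * m ^ 2 ≤ 8 * q * (g x * g y) := by gcongr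
  have t2 : (2 * L - 4 * q * s) * (fderiv ℝ g x e * g y - g x * fderiv ℝ g y e)
      ≤ (2 * L) * (2 * N) :=
    (mul_le_mul_of_nonneg_left (by linarith) φ'0).trans
      (mul_le_mul_of_nonneg_right (by linarith) (by linarith))
  have t3 : φ * (fderiv ℝ (fderiv ℝ g) x e e * g y - 2 * (fderiv ℝ g x e * fderiv ℝ g y e)
      + g x * fderiv ℝ (fderiv ℝ g) y e e) ≤ L * (2 * N + 2 * (N * N)) :=
    (mul_le_mul_of_nonneg_left (by linarith) φ0).trans
      (mul_le_mul_of_nonneg_right φL hNN)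
  have t4 : φ * (fderiv ℝ (fderiv ℝ g) x n n * g y + 2 * (fderiv ℝ g x n * fderiv ℝ g y n)
      + g x * fderiv ℝ (fderiv ℝ g) y n n) ≤ L * (2 * N + 2 * (N * N)) :=
    (mul_le_mul_of_nonneg_left (by linarith) φ0).trans
      (mul_le_mul_of_nonneg_right φL hNN)
  nlinarith

/-- Comparison of the difference of two values of a Neumann function with a concave profile of the
distance. -/
lemma sub_le_profile {Ω : Set V2} (hΩo : IsOpen Ω) (hΩb : Bornology.IsBounded Ω)
    {d : V2 → V2} {g v : V2 → ℝ} {m N K L q r : ℝ}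
    (hg : IsBoundaryWeight Ω d g m N) (hv : ContDiff ℝ 2 v)
    (hv1 : ∀ x ∈ closure Ω, |v x| ≤ 1)
    (hK : ∀ x ∈ Ω, |fderiv ℝ (fderiv ℝ v) x ee1 ee1 + fderiv ℝ (fderiv ℝ v) x ee2 ee2| ≤ K)
    (hN : ∀ x ∈ frontier Ω, fderiv ℝ v x (d x) = 0)
    (hq : 0 ≤ q) (hr0 : 0 < r) (hr : r ≤ 1) (hL : 2 * q * r ≤ L)
    (hLr : 2 ≤ (L * r - q * r ^ 2) * m ^ 2)
    (hbig : 2 * K + L * (12 * N + 4 * N ^ 2) < 8 * q * m ^ 2)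
    {x y : V2} (hx : x ∈ closure Ω) (hy : y ∈ closure Ω) (hxy : ‖x - y‖ ≤ r) :
    v x - v y ≤ (L * ‖x - y‖ - q * ‖x - y‖ ^ 2) * (g x * g y) := by
  by_contra! hcon
  have hgc := hg.contDiff
  have hcpt : IsCompact (closure Ω) := hΩb.isCompact_closure
  have hS : IsCompact ((closure Ω ×ˢ closure Ω) ∩ {p : V2 × V2 | ‖p.1 - p.2‖ ≤ r}) :=
    (hcpt.prod hcpt).inter_right (isClosed_le (by fun_prop) (by fun_prop))
  have hvcont := hv.continuous
  have hgcont := hgc.continuous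
  obtain ⟨⟨x₀, y₀⟩, ⟨⟨hx₀, hy₀⟩, hr₀⟩, hmax⟩ := hS.exists_isMaxOn ⟨(x, y), ⟨hx, hy⟩, hxy⟩
    (f := fun p : V2 × V2 => v p.1 - v p.2
      - (L * ‖p.1 - p.2‖ - q * ‖p.1 - p.2‖ ^ 2) * (g p.1 * g p.2)) (by fun_prop)
  simp only [Set.mem_ofPred_eq] at hx₀ hy₀ hr₀
  have hle : ∀ x' ∈ closure Ω, ∀ y' ∈ closure Ω, ‖x' - y'‖ ≤ r →
      v x' - v y' - (L * ‖x' - y'‖ - q * ‖x' - y'‖ ^ 2) * (g x' * g y')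
        ≤ v x₀ - v y₀ - (L * ‖x₀ - y₀‖ - q * ‖x₀ - y₀‖ ^ 2) * (g x₀ * g y₀) :=
    fun x' hx' y' hy' h' => hmax (a := (x', y')) ⟨⟨hx', hy'⟩, h'⟩
  have hpos : 0 < v x₀ - v y₀ - (L * ‖x₀ - y₀‖ - q * ‖x₀ - y₀‖ ^ 2) * (g x₀ * g y₀) :=
    lt_of_lt_of_le (by linarith) (hle x hx y hy hxy)
  have hm := hg.pos
  have gpos : ∀ z ∈ closure Ω, 0 < g z := fun z hz => hm.trans_le (hg.le_self z hz)
  have hne : x₀ ≠ y₀ := by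
    rintro rfl
    simp at hpos
  have hlt : ‖x₀ - y₀‖ < r := by
    refine lt_of_le_of_ne hr₀ fun heq => ?_
    rw [heq] at hpos
    have h1 := abs_le.1 (hv1 x₀ hx₀)
    have h2 := abs_le.1 (hv1 y₀ hy₀)
    have h3 : m ^ 2 ≤ g x₀ * g y₀ := by
      rw [sq]
      exact mul_le_mul (hg.le_self _ hx₀) (hg.le_self _ hy₀) hm.le (gpos _ hx₀).le
    have h4 : 0 ≤ L * r - q * r ^ 2 := by
      by_contra! h
      nlinarith [mul_nonneg_of_nonpos_of_nonpos h.le (neg_nonpos.2 (sq_nonneg m))]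
    have h5 := mul_le_mul_of_nonneg_left h3 h4
    linarith
  have hqL : 2 * q * ‖x₀ - y₀‖ < L := by
    rcases hq.eq_or_lt with h | h
    · rw [← h] at hLr ⊢
      simp only [zero_mul, mul_zero, sub_zero] at hLr ⊢
      by_contra! hL0
      have := mul_nonpos_of_nonpos_of_nonneg (mul_nonpos_of_nonpos_of_nonneg hL0 hr0.le)
        (sq_nonneg m)
      linarith
    · have : 2 * q * ‖x₀ - y₀‖ < 2 * q * r := by gcongr
      linarith
  have near : ∀ z w e : V2, ‖z - w‖ < r → ∀ᶠ t : ℝ in 𝓝[>] 0, ‖z - t • e - w‖ < r := by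
    intro z w e h
    have hc : Continuous fun t : ℝ => ‖z - t • e - w‖ := by fun_prop
    exact (hc.tendsto 0).mono_left nhdsWithin_le_nhds |>.eventually
      (gt_mem_nhds (by simpa using h))
  by_cases hxΩ : x₀ ∈ Ω
  · by_cases hyΩ : y₀ ∈ Ω
    · refine not_localMax_interior hg hv hx₀ hy₀ hne (hK _ hxΩ) (hK _ hyΩ) hq hr hlt hL hbig ?_
      have hc : Continuous fun p : V2 × V2 => ‖p.1 - p.2‖ := by fun_prop
      filter_upwards [(hΩo.prod hΩo).mem_nhds (⟨hxΩ, hyΩ⟩ : (x₀, y₀) ∈ Ω ×ˢ Ω),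
        (hc.tendsto (x₀, y₀)).eventually (gt_mem_nhds hlt)] with p hp hpr
      exact hle _ (subset_closure hp.1) _ (subset_closure hp.2) hpr.le
    · have hfr : y₀ ∈ frontier Ω := by rw [hΩo.frontier_eq]; exact ⟨hy₀, hyΩ⟩
      have hne' := hne.symm
      refine not_eventually_le_of_boundary (v := fun z => -v z) (y := x₀) (L := L) (q := q)
        (hv.differentiable (by norm_num) y₀).neg (hgc.differentiable (by norm_num) y₀)
        (d := d y₀) (by rw [fderiv_fun_neg]; simp [hN y₀ hfr]) hne'
        (hg.conormal_lt _ hfr _ hx₀ hne') (hg.conormal_nonneg _ hfr) (gpos _ hx₀) hq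
        (by rwa [norm_sub_rev]) ?_
      filter_upwards [hg.inward _ hfr, near y₀ x₀ (d y₀) (by rwa [norm_sub_rev])] with t h1 h2
      rw [norm_sub_rev, norm_sub_rev y₀ x₀]
      rw [norm_sub_rev] at h2
      have := hle x₀ hx₀ _ (subset_closure h1) h2.le
      rw [mul_comm (g _) (g x₀), mul_comm (g y₀) (g x₀)]
      linarith
  · have hfr : x₀ ∈ frontier Ω := by rw [hΩo.frontier_eq]; exact ⟨hx₀, hxΩ⟩
    refine not_eventually_le_of_boundary (v := v) (y := y₀) (L := L) (q := q)
      (hv.differentiable (by norm_num) x₀) (hgc.differentiable (by norm_num) x₀)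
      (d := d x₀) (hN x₀ hfr) hne
      (hg.conormal_lt _ hfr _ hy₀ hne) (hg.conormal_nonneg _ hfr) (gpos _ hy₀) hq hqL ?_
    filter_upwards [hg.inward _ hfr, near x₀ y₀ (d x₀) hlt] with t h1 h2
    have := hle _ (subset_closure h1) y₀ hy₀ h2.le
    linarith

/-- Global Lipschitz estimate, up to the boundary, for functions with bounded Laplacian and
vanishing conormal derivative. -/
lemma exists_neumann_gradient_bound {Ω : Set V2} (hΩo : IsOpen Ω) (hΩb : Bornology.IsBounded Ω)
    {d : V2 → V2} {g : V2 → ℝ} {m N : ℝ} (hg : IsBoundaryWeight Ω d g m N) :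
    ∃ C > 0, ∃ r₀ > 0, ∀ r K : ℝ, 0 < r → r ≤ r₀ → 0 ≤ K → ∀ v : V2 → ℝ, ContDiff ℝ 2 v →
      (∀ x ∈ closure Ω, |v x| ≤ 1) →
      (∀ x ∈ Ω, |fderiv ℝ (fderiv ℝ v) x ee1 ee1 + fderiv ℝ (fderiv ℝ v) x ee2 ee2| ≤ K) →
      (∀ x ∈ frontier Ω, fderiv ℝ v x (d x) = 0) →
      ∀ x ∈ Ω, ‖fderiv ℝ v x‖ ≤ C * (1 / r + r * K) := by
  have hm := hg.pos
  have hN0 := hg.nonneg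
  set N' := 12 * N + 4 * N ^ 2 with hN'
  have hN'0 : 0 ≤ N' := by positivity
  have hm2 : 0 < m ^ 2 := by positivity
  refine ⟨5 / m ^ 2, by positivity, min 1 (2 * m ^ 2 / (N' + 1)), by positivity, ?_⟩
  intro r K hr hrr hK0 v hv hv1 hK hN x hx
  have hr1 : r ≤ 1 := hrr.trans (min_le_left _ _)
  have hr2 : r * (N' + 1) ≤ 2 * m ^ 2 := by
    rw [← le_div_iff₀ (by positivity)]
    exact hrr.trans (min_le_right _ _)
  set L := 5 / m ^ 2 * (1 / r + r * K) with hLdef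
  have hLr : L * m ^ 2 * r = 5 + 5 * r ^ 2 * K := by
    rw [hLdef]; field_simp
  have hL0 : 0 < L := by positivity
  set q := (2 * K + L * N' + 1) / (8 * m ^ 2) with hqdef
  have hq : 8 * q * m ^ 2 = 2 * K + L * N' + 1 := by rw [hqdef]; field_simp
  have hq0 : 0 ≤ q := by positivity
  have hrK : 0 ≤ r * K := by positivity
  have hLm : L * m ^ 2 = 5 * (1 / r + r * K) := by rw [hLdef]; field_simp
  have h1r : 1 ≤ 1 / r := by rw [le_div_iff₀ hr]; linarith
  have hqr : 2 * q * r ≤ L := by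
    have h1 : 8 * m ^ 2 * (2 * q * r) ≤ 8 * m ^ 2 * L := by
      have e1 : 8 * m ^ 2 * (2 * q * r) = 2 * r * (2 * K + L * N' + 1) := by rw [← hq]; ring
      have e2 : L * (r * (N' + 1)) ≤ L * (2 * m ^ 2) := by gcongr
      have e3 : 0 ≤ L * r := by positivity
      rw [e1]
      nlinarith
    exact le_of_mul_le_mul_left h1 (by positivity)
  have hprof : 2 ≤ (L * r - q * r ^ 2) * m ^ 2 := by
    have e1 : q * r ^ 2 ≤ L * r / 2 := by nlinarith
    have e2 : L * r / 2 * m ^ 2 ≤ (L * r - q * r ^ 2) * m ^ 2 := by gcongr; linarith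
    have e3 : 0 ≤ 5 * r ^ 2 * K := by positivity
    linarith
  have key : ∀ y ∈ closure Ω, ‖y - x‖ ≤ r → ‖v y - v x‖ ≤ L * ‖y - x‖ := by
    have hxc := subset_closure hx
    have bound : ∀ y ∈ closure Ω, ∀ z ∈ closure Ω, ‖y - z‖ ≤ r → v y - v z ≤ L * ‖y - z‖ := by
      intro y hy z hz hyz
      have h := sub_le_profile hΩo hΩb hg hv hv1 hK hN hq0 hr hr1 hqr hprof
        (by rw [hq]; linarith) hy hz hyz
      have hs := norm_nonneg (y - z)
      have hqs : q * ‖y - z‖ ≤ q * r := by gcongr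
      have hqs0 : 0 ≤ q * r := by positivity
      have h0 : 0 ≤ ‖y - z‖ * (L - q * ‖y - z‖) := mul_nonneg hs (by linarith)
      have hgg : g y * g z ≤ 1 := mul_le_one₀ (hg.self_le y hy)
        (hm.le.trans (hg.le_self z hz)) (hg.self_le z hz)
      have h2 : (L * ‖y - z‖ - q * ‖y - z‖ ^ 2) * (g y * g z)
          ≤ L * ‖y - z‖ - q * ‖y - z‖ ^ 2 := mul_le_of_le_one_right (by linarith) hgg
      have h3 : 0 ≤ q * ‖y - z‖ ^ 2 := by positivity
      linarith
    intro y hy hyx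
    rw [Real.norm_eq_abs, abs_le]
    have h1 := bound y hy x hxc hyx
    have h2 := bound x hxc y hy (by rwa [norm_sub_rev])
    rw [norm_sub_rev] at h2
    constructor <;> linarith
  refine norm_fderiv_le_of_lip' ℝ hL0.le ?_
  filter_upwards [hΩo.mem_nhds hx, Metric.closedBall_mem_nhds x hr] with y hy hyr
  exact key y (subset_closure hy) (by rwa [← dist_eq_norm])

/-- The (non-normalised) outward conormal field of a smooth domain. -/
def SmoothBdry.conormal {Ω : Set V2} (sb : SmoothBdry Ω) (x : V2) : V2 :=
  mkV (pd1 sb.f x) (pd2 sb.f x)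

lemma fderiv_apply_eq {E : Type*} [NormedAddCommGroup E] [NormedSpace ℝ E] (u : V2 → E)
    (x w : V2) : fderiv ℝ u x w = w 0 • pd1 u x + w 1 • pd2 u x := by
  conv_lhs => rw [eq_smul_ee w]
  simp [pd1, pd2]

lemma SmoothBdry.inner_conormal {Ω : Set V2} (sb : SmoothBdry Ω) (x w : V2) :
    ⟪sb.conormal x, w⟫_ℝ = fderiv ℝ sb.f x w := by
  rw [fderiv_apply_eq, PiLp.inner_apply, Fin.sum_univ_two]
  simp [SmoothBdry.conormal, mkV]

lemma SmoothBdry.conormal_ne_zero {Ω : Set V2} (sb : SmoothBdry Ω) {x : V2}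
    (hx : x ∈ frontier Ω) : sb.conormal x ≠ 0 := by
  intro h
  refine sb.grad_ne x hx ?_
  ext w
  simp [← sb.inner_conormal, h]

lemma SmoothBdry.contDiff_two {Ω : Set V2} (sb : SmoothBdry Ω) : ContDiff ℝ 2 sb.f :=
  contDiff_infty.1 sb.smooth 2

lemma SmoothBdry.mem_iff {Ω : Set V2} (sb : SmoothBdry Ω) (x : V2) : x ∈ Ω ↔ sb.f x < 0 :=
  Set.ext_iff.1 sb.eq_set x

lemma SmoothBdry.nonpos_of_mem_closure {Ω : Set V2} (sb : SmoothBdry Ω) {x : V2}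
    (hx : x ∈ closure Ω) : sb.f x ≤ 0 := by
  have hc : IsClosed {x | sb.f x ≤ 0} := isClosed_le sb.smooth.continuous continuous_const
  exact closure_minimal (fun y hy => ((sb.mem_iff y).1 hy).le) hc hx

lemma SmoothBdry.eq_zero_of_mem_frontier {Ω : Set V2} (sb : SmoothBdry Ω) (hΩo : IsOpen Ω)
    {x : V2} (hx : x ∈ frontier Ω) : sb.f x = 0 := by
  rw [hΩo.frontier_eq] at hx
  refine le_antisymm (sb.nonpos_of_mem_closure hx.1) 
    (not_lt.1 fun h => hx.2 ((sb.mem_iff x).2 h))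

lemma SmoothBdry.eventually_sub_smul_conormal_mem {Ω : Set V2} (sb : SmoothBdry Ω)
    (hΩo : IsOpen Ω) {x : V2} (hx : x ∈ frontier Ω) :
    ∀ᶠ t : ℝ in 𝓝[>] 0, x - t • sb.conormal x ∈ Ω := by
  have line : HasDerivAt (fun t : ℝ => x - t • sb.conormal x) (-sb.conormal x) 0 := by
    simpa using ((hasDerivAt_id (0 : ℝ)).smul_const (sb.conormal x)).const_sub x
  have hf : HasFDerivAt sb.f (fderiv ℝ sb.f x) (x - (0 : ℝ) • sb.conormal x) := by
    simpa using (sb.smooth.differentiable (by simp) x).hasFDerivAt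
  have h := (hf.comp_hasDerivAt 0 line).hasDerivWithinAt (s := Set.Ioi 0)
  rw [hasDerivWithinAt_iff_tendsto_slope' (by simp)] at h
  have hneg : fderiv ℝ sb.f x (-sb.conormal x) < 0 := by
    rw [map_neg, ← sb.inner_conormal, real_inner_self_eq_norm_sq, neg_lt_zero]
    have := norm_pos_iff.2 (sb.conormal_ne_zero hx)
    positivity
  filter_upwards [h.eventually (gt_mem_nhds hneg), self_mem_nhdsWithin] with t ht ht0
  rw [slope_def_field, div_neg_iff] at ht
  simp only [Function.comp_apply, zero_smul, sub_zero, sb.eq_zero_of_mem_frontier hΩo hx] at ht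
  rw [sb.mem_iff]
  rcases ht with ht | ht
  · exact absurd ht.2 (not_lt.2 (le_of_lt ht0))
  · exact ht.1

/-- Quadratic exterior-ball type condition for a smooth bounded domain. -/
lemma SmoothBdry.exists_neg_inner_conormal_le {Ω : Set V2} (sb : SmoothBdry Ω)
    (hΩo : IsOpen Ω) (hΩb : Bornology.IsBounded Ω) :
    ∃ F ≥ 0, ∀ x ∈ frontier Ω, ∀ y ∈ closure Ω,
      -⟪sb.conormal x, x - y⟫_ℝ ≤ F * ‖x - y‖ ^ 2 := by
  obtain ⟨R, hR⟩ := hΩb.closure.subset_closedBall (0 : V2)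
  have hf1 : ContDiff ℝ 1 (fderiv ℝ sb.f) :=
    sb.contDiff_two.fderiv_right (by norm_num)
  obtain ⟨F, hF⟩ := (isCompact_closedBall (0 : V2) R).exists_bound_of_continuousOn
    (hf1.continuous_fderiv (by norm_num)).continuousOn
  refine ⟨max F 0, le_max_right _ _, fun x hx y hy => ?_⟩
  have hxc : x ∈ Metric.closedBall (0 : V2) R := hR (frontier_subset_closure hx)
  have hyc : y ∈ Metric.closedBall (0 : V2) R := hR hy
  have hseg : segment ℝ x y ⊆ Metric.closedBall (0 : V2) R :=
    (convex_closedBall (0 : V2) R).segment_subset hxc hyc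
  have hlip : ∀ z ∈ segment ℝ x y, ‖fderiv ℝ sb.f z - fderiv ℝ sb.f x‖ ≤ max F 0 * ‖y - x‖ := by
    intro z hz
    have h1 := (convex_closedBall (0 : V2) R).norm_image_sub_le_of_norm_fderiv_le
      (fun w _ => hf1.differentiable (by norm_num) w) hF hxc (hseg hz)
    have h2 : ‖z - x‖ ≤ ‖y - x‖ := by
      obtain ⟨θ, hθ, rfl⟩ := (segment_eq_image' ℝ x y ▸ hz)
      simp only [add_sub_cancel_left]
      rw [norm_smul, Real.norm_of_nonneg hθ.1]
      exact mul_le_of_le_one_left (norm_nonneg _) hθ.2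
    refine h1.trans ((mul_le_mul_of_nonneg_right (le_max_left F 0) (norm_nonneg _)).trans ?_)
    exact mul_le_mul_of_nonneg_left h2 (le_max_right _ _)
  have h := (convex_segment x y).norm_image_sub_le_of_norm_fderiv_le'
    (fun z _ => sb.smooth.differentiable (by simp) z) hlip
    (left_mem_segment ℝ x y) (right_mem_segment ℝ x y)
  rw [sb.eq_zero_of_mem_frontier hΩo hx, sub_zero, Real.norm_eq_abs] at h
  have h2 := (abs_le.1 h).1
  have h3 := sb.nonpos_of_mem_closure hy
  rw [sb.inner_conormal, ← map_neg, neg_sub, norm_sub_rev x y]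
  linarith

lemma SmoothBdry.exists_isBoundaryWeight {Ω : Set V2} (sb : SmoothBdry Ω)
    (hΩo : IsOpen Ω) (hΩb : Bornology.IsBounded Ω) :
    ∃ g m N, IsBoundaryWeight Ω sb.conormal g m N := by
  obtain ⟨F, hF0, hF⟩ := sb.exists_neg_inner_conormal_le hΩo hΩb
  have hcl : IsCompact (closure Ω) := hΩb.isCompact_closure
  have hfr : IsCompact (frontier Ω) := hcl.of_isClosed_subset isClosed_frontier
    frontier_subset_closure
  have hfd : Continuous (fderiv ℝ sb.f) := sb.smooth.continuous_fderiv (by simp)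
  have hcont : Continuous fun x => fderiv ℝ sb.f x ee1 ^ 2 + fderiv ℝ sb.f x ee2 ^ 2 := by fun_prop
  have hdd : ∀ x, fderiv ℝ sb.f x (sb.conormal x)
      = fderiv ℝ sb.f x ee1 ^ 2 + fderiv ℝ sb.f x ee2 ^ 2 := by
    intro x
    rw [fderiv_apply_eq]
    simp [SmoothBdry.conormal, mkV, pd1, pd2, sq]
  obtain ⟨c, hc0, hc⟩ := hfr.exists_forall_le' (a := 0) hcont.continuousOn (by
    intro x hx
    rw [← hdd, ← sb.inner_conormal, real_inner_self_eq_norm_sq]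
    have := norm_pos_iff.2 (sb.conormal_ne_zero hx)
    positivity)
  simp only [← hdd] at hc
  set κ := (F + 1) / c with hκ
  have hκ0 : 0 < κ := by positivity
  have hκc : κ * c = F + 1 := by rw [hκ]; field_simp
  obtain ⟨F₀, hF₀⟩ := hcl.exists_bound_of_continuousOn sb.smooth.continuous.continuousOn
  have hg2 : ContDiff ℝ 2 fun x => Real.exp (κ * sb.f x) :=
    (contDiff_const.mul sb.contDiff_two).exp
  have hg1 : ContDiff ℝ 1 (fderiv ℝ fun x => Real.exp (κ * sb.f x)) :=
    hg2.fderiv_right (by norm_num)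
  obtain ⟨N₁, hN₁⟩ := hcl.exists_bound_of_continuousOn hg1.continuous.continuousOn
  obtain ⟨N₂, hN₂⟩ := hcl.exists_bound_of_continuousOn
    (hg1.continuous_fderiv (by norm_num)).continuousOn
  have hDg : ∀ x w, fderiv ℝ (fun x => Real.exp (κ * sb.f x)) x w
      = Real.exp (κ * sb.f x) * (κ * fderiv ℝ sb.f x w) := by
    intro x w
    have h := ((sb.smooth.differentiable (by simp) x).hasFDerivAt.const_mul κ).exp
    rw [h.fderiv]
    simp
  refine ⟨fun x => Real.exp (κ * sb.f x), Real.exp (-(κ * F₀)), max N₁ (max N₂ 0),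
    hg2, Real.exp_pos _, ?_, ?_, by simp, fun x hx => (hN₁ x hx).trans (by simp),
    fun x hx => (hN₂ x hx).trans (by simp),
    fun x hx => sb.eventually_sub_smul_conormal_mem hΩo hx, ?_, ?_⟩
  · intro x hx
    rw [Real.exp_le_exp, ← mul_neg]
    exact mul_le_mul_of_nonneg_left (abs_le.1 (hF₀ x hx)).1 hκ0.le
  · intro x hx
    rw [Real.exp_le_one_iff]
    exact mul_nonpos_of_nonneg_of_nonpos hκ0.le (sb.nonpos_of_mem_closure hx)
  · intro x hx
    have := hc x hx
    rw [hDg]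
    have : 0 ≤ fderiv ℝ sb.f x (sb.conormal x) := hc0.le.trans this
    positivity
  · intro x hx y hy hxy
    have hs : 0 < ‖x - y‖ ^ 2 := by
      have := norm_pos_iff.2 (sub_ne_zero.2 hxy)
      positivity
    have h1 := hF x hx y hy
    have h2 : κ * c ≤ κ * fderiv ℝ sb.f x (sb.conormal x) :=
      mul_le_mul_of_nonneg_left (hc x hx) hκ0.le
    rw [hDg]
    have h3 : -⟪sb.conormal x, x - y⟫_ℝ
        < ‖x - y‖ ^ 2 * (κ * fderiv ℝ sb.f x (sb.conormal x)) := by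
      have := mul_le_mul_of_nonneg_left h2 hs.le
      rw [hκc] at this
      linarith
    have := mul_lt_mul_of_pos_left h3 (Real.exp_pos (κ * sb.f x))
    linarith

lemma fderiv_fderiv_clm_comp {u : V2 → ℂ} (hu : ContDiff ℝ 2 u) (ℓ : ℂ →L[ℝ] ℝ) (x e w : V2) :
    fderiv ℝ (fderiv ℝ fun y => ℓ (u y)) x e w = ℓ (fderiv ℝ (fderiv ℝ u) x e w) := by
  have h1 : (fderiv ℝ fun y => ℓ (u y)) = fun y => ℓ.comp (fderiv ℝ u y) := by
    funext y
    exact (ℓ.hasFDerivAt.comp y (hu.differentiable (by norm_num) y).hasFDerivAt).fderiv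
  have h2 : ContDiff ℝ 1 (fderiv ℝ u) := hu.fderiv_right (by norm_num)
  have h3 := (h2.differentiable (by norm_num) x).hasFDerivAt
  have h4 : fderiv ℝ (fun y => ℓ.comp (fderiv ℝ u y)) x = _ :=
    ((ContinuousLinearMap.compL ℝ V2 ℂ ℝ ℓ).hasFDerivAt.comp x h3).fderiv
  rw [h1, h4]
  simp

lemma fderiv_covariant_apply {u : V2 → ℂ} {c : V2 → ℝ} (hu : ContDiff ℝ 2 u) {x : V2}
    (hc : DifferentiableAt ℝ c x) (e w : V2) :
    fderiv ℝ (fun y => fderiv ℝ u y e - Complex.I * (c y : ℂ) * u y) x w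
      = fderiv ℝ (fderiv ℝ u) x w e
        - Complex.I * ((fderiv ℝ c x w : ℂ) * u x + (c x : ℂ) * fderiv ℝ u x w) := by
  have h2 : ContDiff ℝ 1 (fderiv ℝ u) := hu.fderiv_right (by norm_num)
  have h3 := (h2.differentiable (by norm_num) x).hasFDerivAt.clm_apply (hasFDerivAt_const e x)
  have h4 := Complex.ofRealCLM.hasFDerivAt.comp x hc.hasFDerivAt
  have h5 := (h4.const_mul Complex.I).mul (hu.differentiable (by norm_num) x).hasFDerivAt
  have h6 := (h3.sub h5).fderiv
  have h7 := congrArg (fun T => T w) h6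
  refine h7.trans ?_
  simp
  ring

/-- The first Ginzburg–Landau equation in Coulomb gauge, solved for the Laplacian. -/
lemma laplacian_eq {Ω : Set V2} {a : V2 → ℝ} {ε : ℝ} {u : V2 → ℂ} {A : V2 → V2}
    (hu : ContDiff ℝ 2 u) (hA : ContDiff ℝ 1 A) (heq : GLeq1 Ω a ε u A) {x : V2} (hx : x ∈ Ω)
    (hdiv : div2 A x = 0) :
    fderiv ℝ (fderiv ℝ u) x ee1 ee1 + fderiv ℝ (fderiv ℝ u) x ee2 ee2
      = 2 * Complex.I * fderiv ℝ u x (A x) + ((‖A x‖ ^ 2 : ℝ) : ℂ) * u x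
        - u x * ((a x - ‖u x‖ ^ 2 : ℝ) : ℂ) / (ε : ℂ) ^ 2 := by
  have hAx := hA.differentiable (by norm_num) x
  have hA0 : DifferentiableAt ℝ (fun y => A y 0) x := (differentiableAt_euclidean.1 hAx) 0
  have hA1 : DifferentiableAt ℝ (fun y => A y 1) x := (differentiableAt_euclidean.1 hAx) 1
  have e1 : pd1 (covD1 u A) x = _ := fderiv_covariant_apply hu hA0 ee1 ee1
  have e2 : pd2 (covD2 u A) x = _ := fderiv_covariant_apply hu hA1 ee2 ee2
  have h := heq x hx
  rw [e1, e2] at h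
  have hd : ((fderiv ℝ (fun y => A y 0) x ee1 : ℝ) : ℂ)
      + ((fderiv ℝ (fun y => A y 1) x ee2 : ℝ) : ℂ) = 0 := by exact_mod_cast hdiv
  have hnorm : ((‖A x‖ ^ 2 : ℝ) : ℂ) = (A x 0 : ℂ) ^ 2 + (A x 1 : ℂ) ^ 2 := by
    rw [EuclideanSpace.real_norm_sq_eq, Fin.sum_univ_two]
    push_cast
    rfl
  rw [← h, hnorm, fderiv_apply_eq u x (A x)]
  simp only [covD1, covD2, pd1, pd2, Complex.real_smul]
  have hI : Complex.I ^ 2 = -1 := Complex.I_sq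
  linear_combination (Complex.I * u x) * hd - (((A x 0 : ℂ) ^ 2 + (A x 1 : ℂ) ^ 2) * u x) * hI

lemma norm_laplacian_le {Ω : Set V2} {a : V2 → ℝ} {ε M S : ℝ} {u : V2 → ℂ} {A : V2 → V2}
    (hu : ContDiff ℝ 2 u) (hA : ContDiff ℝ 1 A) (heq : GLeq1 Ω a ε u A) {x : V2} (hx : x ∈ Ω)
    (hdiv : div2 A x = 0) (hε : 0 < ε) (ha : 0 ≤ a x ∧ a x ≤ 1) (hu1 : ‖u x‖ ≤ 1)
    (hM : ‖fderiv ℝ u x‖ ≤ M) (hS : ‖A x‖ ≤ S) :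
    ‖fderiv ℝ (fderiv ℝ u) x ee1 ee1 + fderiv ℝ (fderiv ℝ u) x ee2 ee2‖
      ≤ 2 * (M * S) + S ^ 2 + 1 / ε ^ 2 := by
  rw [laplacian_eq hu hA heq hx hdiv]
  refine (norm_sub_le _ _).trans (add_le_add ((norm_add_le _ _).trans (add_le_add ?_ ?_)) ?_)
  · rw [norm_mul, norm_mul, Complex.norm_I, mul_one, Complex.norm_ofNat]
    refine mul_le_mul_of_nonneg_left ?_ (by norm_num)
    exact ((fderiv ℝ u x).le_opNorm _).trans
      (mul_le_mul hM hS (norm_nonneg _) ((norm_nonneg _).trans hM))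
  · rw [norm_mul, Complex.norm_of_nonneg (by positivity)]
    calc ‖A x‖ ^ 2 * ‖u x‖ ≤ ‖A x‖ ^ 2 := mul_le_of_le_one_right (by positivity) hu1
      _ ≤ S ^ 2 := by gcongr
  · rw [norm_div, norm_mul, norm_pow, Complex.norm_real, Complex.norm_of_nonneg hε.le]
    have h1 : ‖u x‖ ^ 2 ≤ 1 := pow_le_one₀ (norm_nonneg _) hu1
    have h2 : ‖a x - ‖u x‖ ^ 2‖ ≤ 1 := by
      rw [Real.norm_eq_abs, abs_le]
      have := sq_nonneg ‖u x‖
      constructor <;> linarith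
    gcongr
    exact mul_le_one₀ hu1 (norm_nonneg _) h2

lemma fderiv_conormal_eq_zero {Ω : Set V2} (sb : SmoothBdry Ω) {u : V2 → ℂ} {A : V2 → V2}
    (hN : CovNeumann Ω sb u A) (hG : CoulombGauge Ω sb A) {x : V2} (hx : x ∈ frontier Ω) :
    fderiv ℝ u x (sb.conormal x) = 0 := by
  have h1 := hN x hx
  have h2 : (A x 0 : ℂ) * (sb.normal x 0 : ℂ) + (A x 1 : ℂ) * (sb.normal x 1 : ℂ) = 0 := by
    rw [← Complex.ofReal_mul, ← Complex.ofReal_mul, ← Complex.ofReal_add, hG.2 x hx,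
      Complex.ofReal_zero]
  have h3 : fderiv ℝ u x (sb.normal x) = 0 := by
    rw [fderiv_apply_eq, Complex.real_smul, Complex.real_smul]
    simp only [covD1, covD2] at h1
    linear_combination h1 + Complex.I * u x * h2
  have h4 : sb.normal x = ‖sb.conormal x‖⁻¹ • sb.conormal x := rfl
  rw [h4, map_smul, smul_eq_zero] at h3
  exact h3.resolve_left (inv_ne_zero (norm_ne_zero_iff.2 (sb.conormal_ne_zero hx)))

lemma norm_fderiv_div_le {u : V2 → ℂ} {ρ : V2 → ℝ} {x : V2} (hu : DifferentiableAt ℝ u x)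
    (hρ : DifferentiableAt ℝ ρ x) {β P Q : ℝ} (hβ : 0 < β) (hβρ : β ≤ ρ x) (hu1 : ‖u x‖ ≤ 1)
    (hP : ‖fderiv ℝ u x‖ ≤ P) (hQ : ‖fderiv ℝ ρ x‖ ≤ Q) :
    ‖fderiv ℝ (fun y => u y / (ρ y : ℂ)) x‖ ≤ P / β + Q / β ^ 2 := by
  have hρ0 : 0 < ρ x := hβ.trans_le hβρ
  have hinv : HasFDerivAt (fun y => (ρ y)⁻¹) (-(ρ x ^ 2)⁻¹ • fderiv ℝ ρ x) x :=
    (hasDerivAt_inv hρ0.ne').comp_hasFDerivAt x hρ.hasFDerivAt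
  have h := hinv.smul hu.hasFDerivAt
  have hfun : (fun y => u y / (ρ y : ℂ)) = fun y => (ρ y)⁻¹ • u y := by
    funext y
    rw [Complex.real_smul, Complex.ofReal_inv, div_eq_inv_mul]
  rw [hfun]
  have h' : fderiv ℝ (fun y => (ρ y)⁻¹ • u y) x = _ := h.fderiv
  rw [h']
  refine (norm_add_le _ _).trans (add_le_add ?_ ?_)
  · rw [norm_smul, Real.norm_of_nonneg (inv_nonneg.2 hρ0.le), div_eq_inv_mul]
    have : 0 ≤ P := (norm_nonneg _).trans hP
    gcongr
  · rw [ContinuousLinearMap.norm_smulRight_apply, norm_smul, norm_neg,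
      Real.norm_of_nonneg (by positivity), div_eq_inv_mul]
    have hQ0 : 0 ≤ Q := (norm_nonneg _).trans hQ
    calc (ρ x ^ 2)⁻¹ * ‖fderiv ℝ ρ x‖ * ‖u x‖ ≤ (ρ x ^ 2)⁻¹ * ‖fderiv ℝ ρ x‖ :=
          mul_le_of_le_one_right (by positivity) hu1
      _ ≤ (β ^ 2)⁻¹ * Q := by gcongr

/-- Gradient bound for Ginzburg–Landau solutions in Coulomb gauge. -/
lemma exists_gradient_bound {Ω : Set V2} (hΩo : IsOpen Ω) (hΩb : Bornology.IsBounded Ω)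
    (sb : SmoothBdry Ω) {S : ℝ} (hS : 0 < S) :
    ∃ B > 0, ∀ ε : ℝ, 0 < ε → ε ≤ 1 → ∀ a : V2 → ℝ, (∀ x ∈ closure Ω, 0 ≤ a x ∧ a x ≤ 1) →
      ∀ (u : V2 → ℂ) (A : V2 → V2), ContDiff ℝ 2 u → ContDiff ℝ 1 A →
        (∀ x ∈ closure Ω, ‖u x‖ ≤ 1) → GLeq1 Ω a ε u A → CovNeumann Ω sb u A →
        CoulombGauge Ω sb A → (∀ x ∈ Ω, ‖A x‖ ≤ S / ε) → ∀ x ∈ Ω, ‖fderiv ℝ u x‖ ≤ B / ε := by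
  obtain ⟨g, m, N, hg⟩ := sb.exists_isBoundaryWeight hΩo hΩb
  obtain ⟨C, hC, r₀, hr₀, hbound⟩ := exists_neumann_gradient_bound hΩo hΩb hg
  set δ := min r₀ (1 / (8 * C * S)) with hδdef
  have hδ : 0 < δ := by positivity
  have hδC : 8 * C * S * δ ≤ 1 := by
    rw [mul_comm, ← le_div_iff₀ (by positivity)]
    exact min_le_right _ _
  refine ⟨4 * C * (1 / δ + δ * (S ^ 2 + 1)), by positivity, ?_⟩
  intro ε hε hε1 a ha u A hu hA hu1 heq hN hG hAS
  have hr : δ * ε ≤ r₀ := (mul_le_of_le_one_right hδ.le hε1).trans (min_le_left _ _)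
  have improve : ∀ M, 0 ≤ M → (∀ x ∈ Ω, ‖fderiv ℝ u x‖ ≤ M) → ∀ x ∈ Ω,
      ‖fderiv ℝ u x‖ ≤ M / 2 + 2 * C * (1 / δ + δ * (S ^ 2 + 1)) / ε := by
    intro M hM0 hM x hx
    set K := 2 * (M * (S / ε)) + (S / ε) ^ 2 + 1 / ε ^ 2 with hK
    have hlap : ∀ x ∈ Ω,
        ‖fderiv ℝ (fderiv ℝ u) x ee1 ee1 + fderiv ℝ (fderiv ℝ u) x ee2 ee2‖ ≤ K :=
      fun x hx => norm_laplacian_le hu hA heq hx (hG.1 x hx) hε (ha x (subset_closure hx))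
        (hu1 x (subset_closure hx)) (hM x hx) (hAS x hx)
    have part : ∀ ℓ : ℂ →L[ℝ] ℝ, (∀ z, |ℓ z| ≤ ‖z‖) →
        ‖ℓ.comp (fderiv ℝ u x)‖ ≤ C * (1 / (δ * ε) + δ * ε * K) := by
      intro ℓ hℓ
      have hd : ∀ y, fderiv ℝ (fun y => ℓ (u y)) y = ℓ.comp (fderiv ℝ u y) := fun y =>
        (ℓ.hasFDerivAt.comp y (hu.differentiable (by norm_num) y).hasFDerivAt).fderiv
      rw [← hd]
      refine hbound (δ * ε) K (by positivity) hr (by positivity)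
        (fun y => ℓ (u y)) (ℓ.contDiff.comp hu)
        (fun y hy => (hℓ _).trans (hu1 y hy)) (fun y hy => ?_) (fun y hy => ?_) x hx
      · rw [fderiv_fderiv_clm_comp hu, fderiv_fderiv_clm_comp hu, ← map_add]
        exact (hℓ _).trans (hlap y hy)
      · rw [hd, ContinuousLinearMap.comp_apply, fderiv_conormal_eq_zero sb hN hG hy, map_zero]
    have hre := part Complex.reCLM Complex.abs_re_le_norm
    have him := part Complex.imCLM Complex.abs_im_le_norm
    have hsum : ‖fderiv ℝ u x‖ ≤ 2 * (C * (1 / (δ * ε) + δ * ε * K)) := by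
      refine ContinuousLinearMap.opNorm_le_bound _ (by positivity) fun w => ?_
      have h1 := (Complex.reCLM.comp (fderiv ℝ u x)).le_of_opNorm_le hre w
      have h2 := (Complex.imCLM.comp (fderiv ℝ u x)).le_of_opNorm_le him w
      have h3 := Complex.norm_le_abs_re_add_abs_im (fderiv ℝ u x w)
      simp only [ContinuousLinearMap.comp_apply, Complex.reCLM_apply, Complex.imCLM_apply,
        Real.norm_eq_abs] at h1 h2
      linarith
    have hexp : 2 * (C * (1 / (δ * ε) + δ * ε * K))
        = 8 * C * S * δ * (M / 2) + 2 * C * (1 / δ + δ * (S ^ 2 + 1)) / ε := by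
      rw [hK]; field_simp; ring
    have : 8 * C * S * δ * (M / 2) ≤ M / 2 := mul_le_of_le_one_left (by positivity) hδC
    linarith
  have hcont : Continuous (fderiv ℝ u) := hu.continuous_fderiv (by norm_num)
  obtain ⟨M₀, hM₀⟩ := hΩb.isCompact_closure.exists_bound_of_continuousOn hcont.continuousOn
  intro x hx
  have hbdd : BddAbove ((fun y => ‖fderiv ℝ u y‖) '' Ω) :=
    ⟨M₀, by rintro _ ⟨y, hy, rfl⟩; exact hM₀ y (subset_closure hy)⟩
  set M := sSup ((fun y => ‖fderiv ℝ u y‖) '' Ω) with hMdef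
  have hM : ∀ y ∈ Ω, ‖fderiv ℝ u y‖ ≤ M := fun y hy => le_csSup hbdd ⟨y, hy, rfl⟩
  have hM0 : 0 ≤ M := (norm_nonneg _).trans (hM x hx)
  have hself : M ≤ M / 2 + 2 * C * (1 / δ + δ * (S ^ 2 + 1)) / ε := by
    refine csSup_le ⟨_, x, hx, rfl⟩ ?_
    rintro _ ⟨y, hy, rfl⟩
    exact improve M hM0 hM y hy
  have hfin : 4 * C * (1 / δ + δ * (S ^ 2 + 1)) / ε
      = 2 * (2 * C * (1 / δ + δ * (S ^ 2 + 1)) / ε) := by ring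
  rw [hfin]
  linarith [hM x hx]

/-- interior gradient bounds ‖∇𝐮‖_∞ ≤ C/ε and ‖∇(𝐮/ρ)‖_∞ ≤ C/ε. -/
theorem statement14
    (Ω : Set V2) (hΩo : IsOpen Ω) (hΩb : Bornology.IsBounded Ω)
    (sb : SmoothBdry Ω)
    (b : ℝ) (hb : b ∈ Set.Ioo (0 : ℝ) 1)
    (Ct C1 : ℝ) (hCt : 0 < Ct) (hC1 : 0 < C1) :
    ∃ C > 0, ∀ (ε : ℝ), ε ∈ Set.Ioc (0 : ℝ) 1 →
      ∀ (a : V2 → ℝ), ContinuousOn a (closure Ω) →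
        (∀ x ∈ closure Ω, b ≤ a x ∧ a x ≤ 1) →
      ∀ (ρ : V2 → ℝ), ContDiff ℝ 1 ρ →
        (∀ x ∈ closure Ω, Real.sqrt b ≤ ρ x ∧ ρ x ≤ 1) →
        (∀ x ∈ Ω, ‖fderiv ℝ ρ x‖ ≤ C1 / ε) →
      ∀ (uu : V2 → ℂ) (A : V2 → V2), ContDiff ℝ 2 uu → ContDiff ℝ 1 A →
        (∀ x ∈ closure Ω, ‖uu x‖ ≤ 1) →
        GLeq1 Ω a ε uu A →
        CovNeumann Ω sb uu A →
        CoulombGauge Ω sb A →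
        (∀ x ∈ Ω, ‖A x‖ ≤ Ct / ε) →
        ∀ x ∈ Ω, ‖fderiv ℝ uu x‖ ≤ C / ε
          ∧ ‖fderiv ℝ (fun y => uu y / (ρ y : ℂ)) x‖ ≤ C / ε := by
  obtain ⟨B, hB, hbound⟩ := exists_gradient_bound hΩo hΩb sb hCt
  have hb0 : 0 < b := hb.1
  have hsb : 0 < Real.sqrt b := Real.sqrt_pos.2 hb0
  have hsb1 : Real.sqrt b ≤ 1 := Real.sqrt_le_one.2 hb.2.le
  refine ⟨B / Real.sqrt b + C1 / b, by positivity, ?_⟩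
  intro ε hε a _ ha ρ hρ hρb hρ1 uu A hu hA hu1 heq hN hG hAS x hx
  have hxc := subset_closure hx
  have hε0 : 0 < ε := hε.1
  have hgrad := hbound ε hε0 hε.2 a (fun y hy => ⟨hb0.le.trans (ha y hy).1, (ha y hy).2⟩)
    uu A hu hA hu1 heq hN hG hAS x hx
  refine ⟨hgrad.trans ?_, ?_⟩
  · have h1 : B ≤ B / Real.sqrt b := le_div_self hB.le hsb hsb1
    have h2 : 0 ≤ C1 / b := by positivity
    gcongr
    linarith
  · refine (norm_fderiv_div_le (hu.differentiable (by norm_num) x)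
      (hρ.differentiable (by norm_num) x) hsb (hρb x hxc).1 (hu1 x hxc) hgrad
      (hρ1 x hx)).trans (le_of_eq ?_)
    rw [Real.sq_sqrt hb0.le]
    field_simp
end
end
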